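/- arXiv:1501.06982 — 2 statements merged into one kernel-verified Lean document; each statement's English description precedes it below -/
import Mathlib

section
/- Let K have characteristic zero, R = K[x₁,…,xₙ] with the Sₙ permutation action, and I = (f₁,…,fₙ) an ideal generated by a regular sequence of quadrics with fᵢ^σ = f_{σ(i)} for all σ ∈ Sₙ. If n ≥ 3 and e₁² ∉ I where e₁ = x₁+⋯+xₙ, then (I ∩ e₁R) ∩ R₂ = 0. -/
open MvPolynomial

section Helpers

open RingTheory Sequence Pointwise

lemma aux_supportDim_le {R : Type*} [CommRing R] [IsNoetherianRing R] (rs : List R) :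
    ∀ {M : Type _} [AddCommGroup M] [Module R M] [Module.Finite R M],
      IsWeaklyRegular M rs →
      Module.supportDim R (M ⧸ Ideal.ofList rs • (⊤ : Submodule R M)) + rs.length
        ≤ Module.supportDim R M := by
  induction rs with
  | nil =>
    intro M _ _ _ _
    rw [Ideal.ofList_nil, Submodule.bot_smul]
    simpa using (Module.supportDim_eq_of_equiv (Submodule.quotEquivOfEqBot ⊥ rfl)).le
  | cons x rs' ih =>
    intro M _ _ _ reg
    have h := (isWeaklyRegular_cons_iff M _ _).mp reg
    have h1 := ih h.2
    have h2 : Module.supportDim R (QuotSMulTop x M) + 1 ≤ Module.supportDim R M :=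
      Module.supportDim_quotSMulTop_succ_le_of_notMem_minimalPrimes
        (fun _ ↦ h.1.notMem_of_mem_minimalPrimes)
    rw [Module.supportDim_eq_of_equiv
      (Submodule.quotOfListConsSMulTopEquivQuotSMulTopInner M x _)]
    refine le_trans ?_ h2
    rw [List.length_cons, Nat.cast_add, ← add_assoc]
    gcongr
    simp

lemma aux_krullDim_le {R : Type*} [CommRing R] [IsNoetherianRing R] (rs : List R)
    (reg : IsWeaklyRegular R rs) :
    ringKrullDim (R ⧸ Ideal.ofList rs) + rs.length ≤ ringKrullDim R := by
  have eq : Ideal.ofList rs = Ideal.ofList rs • (⊤ : Ideal R) := by simp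
  rw [ringKrullDim_eq_of_ringEquiv (Ideal.quotientEquivAlgOfEq R eq).toRingEquiv,
    ← Module.supportDim_quotient_eq_ringKrullDim, ← Module.supportDim_self_eq_ringKrullDim]
  exact aux_supportDim_le rs reg

/-- A regular sequence of length `n` in `n` variables admits no curve of zeros. -/
lemma aux_no_zero {K L : Type*} [Field K] [Field L] {n : ℕ}
    (f : Fin n → MvPolynomial (Fin n) K)
    (hreg : IsRegular (MvPolynomial (Fin n) K) (List.ofFn f))
    (φ : MvPolynomial (Fin n) K →+* Polynomial L) (hf : ∀ i, φ (f i) = 0)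
    (x : MvPolynomial (Fin n) K) (hx : φ x = Polynomial.X) : False := by
  have h1 := aux_krullDim_le _ hreg.toIsWeaklyRegular
  rw [MvPolynomial.ringKrullDim_of_isNoetherianRing, ringKrullDim_eq_zero_of_field] at h1
  simp only [List.length_ofFn, Nat.card_fin, Nat.card_eq_fintype_card, Fintype.card_fin] at h1
  have h2 : ringKrullDim (MvPolynomial (Fin n) K ⧸ Ideal.ofList (List.ofFn f)) ≤ 0 := by
    have : ((n : ℕ) : WithBot ℕ∞) = ((n : ℕ∞) : WithBot ℕ∞) := rfl
    generalize ringKrullDim (MvPolynomial (Fin n) K ⧸ Ideal.ofList (List.ofFn f)) = d at h1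
    induction d with
    | bot => exact bot_le
    | coe d =>
      rw [this] at h1
      have h3 : d + (n : ℕ∞) ≤ 0 + n := by exact_mod_cast h1
      have h4 : d ≤ 0 := (ENat.add_le_add_iff_right (ENat.natCast_ne_top n)).mp h3
      exact_mod_cast h4
  have : Ring.KrullDimLE 0 (MvPolynomial (Fin n) K ⧸ Ideal.ofList (List.ofFn f)) :=
    Ring.krullDimLE_iff.mpr (by simpa using h2)
  have hle : ∀ a ∈ Ideal.ofList (List.ofFn f), φ a = 0 := by
    intro a ha
    have : Ideal.ofList (List.ofFn f) ≤ RingHom.ker φ := by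
      rw [Ideal.ofList, Ideal.span_le]
      intro y hy
      simp only [Set.mem_ofPred_eq, List.mem_ofFn] at hy
      obtain ⟨i, rfl⟩ := hy
      exact hf i
    exact this ha
  let ψ := Ideal.Quotient.lift _ φ hle
  have hmax : (RingHom.ker ψ).IsMaximal := (RingHom.ker_isPrime ψ).isMaximal'
  have hxn : Ideal.Quotient.mk _ x ∉ RingHom.ker ψ := by
    rw [RingHom.mem_ker]
    simp [ψ, hx]
  obtain ⟨y, z, hz, hy⟩ := hmax.exists_inv hxn
  replace hy := congrArg ψ hy
  rw [map_add, RingHom.mem_ker.mp hz, add_zero, map_mul] at hy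
  have : ψ (Ideal.Quotient.mk _ x) = Polynomial.X := by simp [ψ, hx]
  rw [this, map_one] at hy
  exact Polynomial.not_isUnit_X (IsUnit.of_mul_eq_one (ψ y) (by rw [mul_comm]; exact hy))

lemma aux_scale {K A σ : Type*} [CommRing K] [CommRing A] [Algebra K A]
    (g : MvPolynomial σ K) (k : ℕ) (hg : g.IsHomogeneous k) (c : A) (q : σ → A) :
    aeval (fun i => c * q i) g = c ^ k * aeval q g := by
  rw [aeval_def, aeval_def, eval₂_eq, eval₂_eq, Finset.mul_sum]
  refine Finset.sum_congr rfl fun d hd => ?_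
  have hdk : ∑ i ∈ d.support, d i = k := by
    by_contra hne
    exact mem_support_iff.mp hd (hg.coeff_eq_zero hne)
  simp_rw [mul_pow]
  rw [Finset.prod_mul_distrib, Finset.prod_pow_eq_pow_sum, hdk]
  ring

lemma aux_comp_mul {K σ : Type*} [CommRing K] (a b : MvPolynomial σ K) (i j : ℕ)
    (hb : b.IsHomogeneous j) :
    homogeneousComponent (i + j) (a * b) = homogeneousComponent i a * b := by
  letI := MvPolynomial.gradedAlgebra (σ := σ) (R := K)
  have := DirectSum.coe_decompose_mul_add_of_right_mem (homogeneousSubmodule σ K)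
    (i := i) (j := j) (a := a) (b := b) hb
  rw [← decomposition.decompose'_apply, ← decomposition.decompose'_apply]
  exact this

lemma aux_linear {K : Type*} [CommRing K] {n : ℕ} (l : MvPolynomial (Fin n) K)
    (hl : l.IsHomogeneous 1) : l = ∑ i, C (coeff (Finsupp.single i 1) l) * X i := by
  classical
  ext d
  simp only [coeff_sum, coeff_C_mul, coeff_X]
  by_cases hd : d.degree = 1
  · obtain ⟨i, rfl⟩ := (Finsupp.sum_eq_one_iff d).mp hd
    simp [Finsupp.single_left_inj]
  · rw [hl.coeff_eq_zero hd, eq_comm]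
    refine Finset.sum_eq_zero fun i _ => ?_
    rw [if_neg, mul_zero]
    rintro rfl
    simp at hd

end Helpers

theorem intersection_with_e1R_in_degree_two
    (K : Type*) [Field K] [CharZero K] (n : ℕ) (hn : 3 ≤ n)
    (f : Fin n → MvPolynomial (Fin n) K)
    (hquad : ∀ i, (f i).IsHomogeneous 2)
    (hreg : RingTheory.Sequence.IsRegular (MvPolynomial (Fin n) K) (List.ofFn f))
    (hequiv : ∀ (σ : Equiv.Perm (Fin n)) (i : Fin n), rename σ (f i) = f (σ i))
    (e1 : MvPolynomial (Fin n) K) (he1 : e1 = ∑ i, X i)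
    (he12 : e1 ^ 2 ∉ Ideal.span (Set.range f)) :
    ∀ h : MvPolynomial (Fin n) K, h ∈ Ideal.span (Set.range f) →
      h ∈ Ideal.span {e1} → h.IsHomogeneous 2 → h = 0 := by
  intro h hI he hh
  by_contra hne
  have he1h : e1.IsHomogeneous 1 := by
    rw [he1]; exact IsHomogeneous.sum _ _ _ fun i _ => isHomogeneous_X _ _
  have hsym : ∀ σ : Equiv.Perm (Fin n), rename σ e1 = e1 := by
    intro σ
    rw [he1, map_sum]
    simp only [rename_X]
    exact Equiv.sum_comp σ (fun i => (X i : MvPolynomial (Fin n) K))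
  -- `h` is a linear combination of the `f i`
  obtain ⟨c, hc⟩ : ∃ c : Fin n → K, h = ∑ i, C (c i) * f i := by
    obtain ⟨g, hg⟩ := (Ideal.mem_span_range_iff_exists_fun).mp hI
    refine ⟨fun i => coeff 0 (g i), ?_⟩
    have h0 : homogeneousComponent 2 h = h := by
      rw [homogeneousComponent_of_mem hh, if_pos rfl]
    rw [← h0, ← hg, map_sum]
    refine Finset.sum_congr rfl fun i _ => ?_
    have := aux_comp_mul (g i) (f i) 0 2 (hquad i)
    rw [zero_add] at this
    rw [this, homogeneousComponent_zero]
  -- `h = l * e1` with `l` linear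
  obtain ⟨l, hl, hle⟩ : ∃ l : MvPolynomial (Fin n) K, l.IsHomogeneous 1 ∧ h = l * e1 := by
    obtain ⟨a, ha⟩ := Ideal.mem_span_singleton'.mp he
    refine ⟨homogeneousComponent 1 a, homogeneousComponent_isHomogeneous _ _, ?_⟩
    rw [← aux_comp_mul a e1 1 1 he1h, ha, homogeneousComponent_of_mem hh, if_pos rfl]
  have he1ne : e1 ≠ 0 := by
    rintro h0
    rw [h0, mul_zero] at hle
    exact hne hle
  by_cases hall : ∀ i j, c i = c j
  · -- the symmetric case
    have hhsym : ∀ σ : Equiv.Perm (Fin n), rename σ h = h := by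
      intro σ
      rw [hc, map_sum]
      simp only [map_mul, rename_C, hequiv]
      rw [← Equiv.sum_comp σ (fun i => C (c i) * f i)]
      exact Finset.sum_congr rfl fun i _ => by rw [hall i (σ i)]
    have hlsym : ∀ σ : Equiv.Perm (Fin n), rename σ l = l := by
      intro σ
      have := hhsym σ
      rw [hle, map_mul, hsym] at this
      exact mul_right_cancel₀ he1ne this
    let i0 : Fin n := ⟨0, by omega⟩
    have hco : ∀ i, coeff (Finsupp.single i 1) l = coeff (Finsupp.single i0 1) l := by
      intro i
      have h1 := coeff_rename_mapDomain (Equiv.swap i0 i) (Equiv.injective _) l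
        (Finsupp.single i0 1)
      rw [hlsym, Finsupp.mapDomain_single, Equiv.swap_apply_left] at h1
      exact h1
    have hl2 : l = C (coeff (Finsupp.single i0 1) l) * e1 := by
      conv_lhs => rw [aux_linear l hl]
      simp_rw [hco]
      rw [he1, Finset.mul_sum]
    set a := coeff (Finsupp.single i0 1) l with ha
    have ha0 : a ≠ 0 := by
      intro h0
      rw [h0, C_0, zero_mul] at hl2
      rw [hl2, zero_mul] at hle
      exact hne hle
    apply he12
    have : e1 ^ 2 = C a⁻¹ * h := by
      rw [hle, hl2]
      have : (C a⁻¹ * C a : MvPolynomial (Fin n) K) = 1 := by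
        rw [← C_mul, inv_mul_cancel₀ ha0, C_1]
      linear_combination (-e1 ^ 2) * this
    rw [this]
    exact Ideal.mul_mem_left _ _ hI
  · push Not at hall
    obtain ⟨i, j, hij⟩ := hall
    have hijne : i ≠ j := fun h => hij (by rw [h])
    -- `f i - f j` is divisible by `e1`
    have hd1 : e1 ∣ f i - f j := by
      have hsw : h - rename (Equiv.swap i j) h = C (c i - c j) * (f i - f j) := by
        have h1 : rename (Equiv.swap i j) h = ∑ k, C (c (Equiv.swap i j k)) * f k := by
          rw [hc, map_sum]
          simp only [map_mul, rename_C, hequiv]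
          rw [← Equiv.sum_comp (Equiv.swap i j)]
          simp
        rw [h1, hc, ← Finset.sum_sub_distrib]
        rw [Finset.sum_eq_add_of_mem i j (Finset.mem_univ _) (Finset.mem_univ _) hijne]
        · simp only [Equiv.swap_apply_left, Equiv.swap_apply_right, C_sub]
          ring
        · intro k _ hk
          rw [Equiv.swap_apply_of_ne_of_ne hk.1 hk.2, sub_self]
      have hdv : e1 ∣ C (c i - c j) * (f i - f j) := by
        rw [← hsw]
        refine dvd_sub ⟨l, by rw [hle, mul_comm]⟩ ⟨rename (Equiv.swap i j) l, ?_⟩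
        rw [hle, map_mul, hsym, mul_comm]
      have hu : IsUnit (C (c i - c j) : MvPolynomial (Fin n) K) :=
        (IsUnit.mk0 _ (sub_ne_zero.mpr hij)).map C
      exact (hu.dvd_mul_left).mp hdv
    have hd : ∀ k m, e1 ∣ f k - f m := by
      intro k m
      by_cases hkm : k = m
      · simp [hkm]
      obtain ⟨σ, hσ1, hσ2⟩ : ∃ σ : Equiv.Perm (Fin n), σ i = k ∧ σ j = m := by
        refine ⟨Equiv.swap (Equiv.swap i k j) m * Equiv.swap i k, ?_, ?_⟩
        · rw [Equiv.Perm.mul_apply, Equiv.swap_apply_left, Equiv.swap_apply_of_ne_of_ne _ hkm]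
          intro h
          apply hijne
          apply (Equiv.swap i k).injective
          rw [← h, Equiv.swap_apply_left]
        · rw [Equiv.Perm.mul_apply, Equiv.swap_apply_left]
      obtain ⟨r, hr⟩ := hd1
      refine ⟨rename σ r, ?_⟩
      rw [← hσ1, ← hσ2, ← hequiv, ← hequiv, ← map_sub, hr, map_mul, hsym]
    -- the point `(1, ω, ω², 0, …, 0)`
    let L := AlgebraicClosure K
    obtain ⟨w, hw⟩ : ∃ w : L, w ^ 2 + w + 1 = 0 := by
      obtain ⟨w, hw⟩ := IsAlgClosed.exists_root
        (Polynomial.X ^ 2 + Polynomial.X + 1 : Polynomial L) (by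
          have : (Polynomial.X ^ 2 + Polynomial.X + 1 : Polynomial L).degree = 2 := by
            compute_degree!
          rw [this]; norm_num)
      exact ⟨w, by simpa using hw⟩
    have hw2 : w ^ 2 ≠ 1 := by
      intro h2
      have h3 : w = -2 := by linear_combination hw - h2
      rw [h3] at h2
      norm_num at h2
    let a0 : Fin n := ⟨0, by omega⟩
    let a1 : Fin n := ⟨1, by omega⟩
    let a2 : Fin n := ⟨2, by omega⟩
    have h01 : a0 ≠ a1 := by simp [a0, a1]
    have h02 : a0 ≠ a2 := by simp [a0, a2]
    have h12 : a1 ≠ a2 := by simp [a1, a2]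
    let p : Fin n → L := fun i =>
      (if i = a0 then 1 else 0) + (if i = a1 then w else 0) + (if i = a2 then w ^ 2 else 0)
    let q : Fin n → Polynomial L := fun i => Polynomial.C (p i) * Polynomial.X
    let σ : Equiv.Perm (Fin n) := Equiv.swap a0 a1 * Equiv.swap a1 a2
    have hs0 : σ a0 = a1 := by
      simp [σ, Equiv.swap_apply_of_ne_of_ne h01 h02]
    have hs1 : σ a1 = a2 := by
      simp [σ, Equiv.swap_apply_of_ne_of_ne h02.symm h12.symm]
    have hs2 : σ a2 = a0 := by simp [σ]
    have hw3 : w * w ^ 2 = 1 := by linear_combination (w - 1) * hw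
    have hpσ : ∀ i, p (σ i) = w * p i := by
      intro i
      by_cases i0 : i = a0
      · subst i0; rw [hs0]; simp [p, h01, h02, h12, h01.symm]
      by_cases i1 : i = a1
      · subst i1; rw [hs1]; simp [p, h12, h02.symm, h12.symm, h01.symm]; ring
      by_cases i2 : i = a2
      · subst i2; rw [hs2]; simp [p, h01, h02, h02.symm, h12.symm, hw3]
      have : σ i = i := by
        simp only [σ, Equiv.Perm.mul_apply]
        rw [Equiv.swap_apply_of_ne_of_ne i1 i2, Equiv.swap_apply_of_ne_of_ne i0 i1]
      rw [this]; simp [p, i0, i1, i2]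
    have hqσ : q ∘ σ = fun i => Polynomial.C w * q i := by
      funext i
      simp only [q, Function.comp, hpσ, Polynomial.C_mul, mul_assoc]
    have hqe : aeval q e1 = 0 := by
      rw [he1, map_sum]
      simp only [aeval_X, q]
      rw [← Finset.sum_mul, ← map_sum]
      have : ∑ i, p i = 0 := by
        simp only [p, Finset.sum_add_distrib, Finset.sum_ite_eq', Finset.mem_univ, if_true]
        linear_combination hw
      rw [this, Polynomial.C_0, zero_mul]
    have hqf : ∀ k, aeval q (f k) = 0 := by
      intro k
      have e2 : aeval q (f (σ k)) = aeval q (f k) := by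
        obtain ⟨r, hr⟩ := hd (σ k) k
        rw [← sub_eq_zero, ← map_sub, hr, map_mul, hqe, zero_mul]
      rw [← hequiv, aeval_rename, hqσ, aux_scale _ 2 (hquad k)] at e2
      have e3 : Polynomial.C (w ^ 2 - 1) * aeval q (f k) = 0 := by
        rw [Polynomial.C_sub, Polynomial.C_pow, Polynomial.C_1]
        linear_combination e2
      rcases mul_eq_zero.mp e3 with h | h
      · exact absurd (Polynomial.C_eq_zero.mp h) (sub_ne_zero.mpr hw2)
      · exact h
    refine aux_no_zero f hreg (aeval q : _ →ₐ[K] _).toRingHom hqf (X a0) ?_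
    change aeval q (X a0) = _
    simp [q, p, h01, h02]
end

section
/- Let K have characteristic zero, R = K[x₁,…,xₙ], and I = (f₁,…,fₙ) a complete intersection ideal of quadrics with fᵢ^σ = f_{σ(i)} for all σ ∈ Sₙ. If e₁² ∉ I, where e₁ = x₁+⋯+xₙ, then I + e₁R = (x₁², x₂², …, xₙ², e₁) as ideals of R. -/
open MvPolynomial

theorem aux_perm_const {n : ℕ} {K : Type*} [Field K] (g : Fin n → Fin n → Fin n → K)
    (hg : ∀ (σ : Equiv.Perm (Fin n)) i j k, g (σ i) (σ j) (σ k) = g i j k)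
    (k : ℕ) (t : (Fin k → Fin n) → K)
    (ht : ∀ (σ : Equiv.Perm (Fin n)) u, t (σ ∘ u) = t u) :
    ∃ a, ∀ u, Function.Injective u → t u = a := by
  by_cases h : ∃ u : Fin k → Fin n, Function.Injective u
  · obtain ⟨u, hu⟩ := h
    refine ⟨t u, fun v hv => ?_⟩
    obtain ⟨σ, hσ⟩ := Equiv.Perm.exists_extending_pair u v hu hv
    rw [← ht σ u]
    congr 1
    ext a
    simp [hσ]
  · exact ⟨0, fun u hu => (h ⟨u, hu⟩).elim⟩

theorem aux_pattern {n : ℕ} {K : Type*} [Field K] (g : Fin n → Fin n → Fin n → K)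
    (hg : ∀ (σ : Equiv.Perm (Fin n)) i j k, g (σ i) (σ j) (σ k) = g i j k) :
    ∃ A B B' C D : K, ∀ i j k, g i j k =
      (if j = i then (if k = i then A else 0) else 0) + (if j = i then B else 0)
        + (if k = i then B' else 0)
        + (if j = k then C else 0) + D := by
  obtain ⟨a, ha⟩ := aux_perm_const g hg 1 (fun u => g (u 0) (u 0) (u 0)) (by simp [hg])
  obtain ⟨b, hb⟩ := aux_perm_const g hg 2 (fun u => g (u 0) (u 0) (u 1)) (by simp [hg])
  obtain ⟨b', hb'⟩ := aux_perm_const g hg 2 (fun u => g (u 0) (u 1) (u 0)) (by simp [hg])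
  obtain ⟨c, hc⟩ := aux_perm_const g hg 2 (fun u => g (u 0) (u 1) (u 1)) (by simp [hg])
  obtain ⟨d, hd⟩ := aux_perm_const g hg 3 (fun u => g (u 0) (u 1) (u 2)) (by simp [hg])
  have h2 : ∀ i j : Fin n, i ≠ j → Function.Injective ![i, j] := by
    intro i j h x y; fin_cases x <;> fin_cases y <;> simp [h, h.symm]
  have h3 : ∀ i j k : Fin n, i ≠ j → i ≠ k → j ≠ k → Function.Injective ![i, j, k] := by
    intro i j k h h' h'' x y
    fin_cases x <;> fin_cases y <;> simp [h, h.symm, h', h'.symm, h'', h''.symm]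
  refine ⟨a - b - b' - c + 2 * d, b - d, b' - d, c - d, d, fun i j k => ?_⟩
  by_cases hji : j = i
  · subst hji
    by_cases hki : k = j
    · subst hki
      have := ha ![k] (fun x y _ => Subsingleton.elim x y)
      simp at this ⊢
      rw [this]; ring
    · have := hb ![j, k] (h2 _ _ (Ne.symm hki))
      simp at this
      simp [hki, Ne.symm hki, this]
  · by_cases hki : k = i
    · subst hki
      have := hb' ![k, j] (h2 _ _ (Ne.symm hji))
      simp at this
      simp [hji, this]
    · by_cases hjk : j = k
      · subst hjk
        have := hc ![i, j] (h2 _ _ (Ne.symm hji))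
        simp at this
        simp [hji, this]
      · have := hd ![i, j, k] (h3 _ _ _ (Ne.symm hji) (Ne.symm hki) hjk)
        simp at this
        simp [hji, hki, hjk, this]

theorem aux_expand {n : ℕ} {K : Type*} [Field K] (f : MvPolynomial (Fin n) K)
    (hf : f.IsHomogeneous 2) :
    2 * f = ∑ j, ∑ k, X j * X k * C (constantCoeff (pderiv k (pderiv j f))) := by
  have h1 := hf.sum_X_mul_pderiv
  rw [nsmul_eq_mul] at h1
  push_cast at h1
  rw [← h1]
  refine Finset.sum_congr rfl fun j _ => ?_
  have hj : (pderiv j f).IsHomogeneous 1 := hf.pderiv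
  have h2 := hj.sum_X_mul_pderiv
  rw [one_smul] at h2
  conv_lhs => rw [← h2]
  rw [Finset.mul_sum]
  refine Finset.sum_congr rfl fun k _ => ?_
  have hk : (pderiv k (pderiv j f)).IsHomogeneous 0 := hj.pderiv
  rw [← totalDegree_zero_iff_isHomogeneous, totalDegree_eq_zero_iff_eq_C] at hk
  rw [constantCoeff_eq, ← hk, mul_assoc]

theorem aux_form {n : ℕ} {K : Type*} [Field K] [CharZero K]
    (f : Fin n → MvPolynomial (Fin n) K)
    (hquad : ∀ i, (f i).IsHomogeneous 2)
    (hequiv : ∀ (σ : Equiv.Perm (Fin n)) (i : Fin n), rename σ (f i) = f (σ i)) :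
    ∃ a b c d : K, ∀ i, f i = C a * X i ^ 2 + C b * X i * (∑ j, X j)
      + C c * (∑ j, X j ^ 2) + C d * (∑ j, X j) ^ 2 := by
  obtain ⟨A, B, B', E, D, h⟩ := aux_pattern
    (fun i j k => constantCoeff (pderiv k (pderiv j (f i)))) (by
      intro σ i j k
      rw [← hequiv σ i, pderiv_rename σ.injective, pderiv_rename σ.injective,
        constantCoeff_rename])
  refine ⟨A / 2, (B + B') / 2, E / 2, D / 2, fun i => ?_⟩
  have h2 : (2 : MvPolynomial (Fin n) K) ≠ 0 := two_ne_zero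
  apply mul_left_cancel₀ h2
  have hc : ∀ x : K, C x = 2 * (C (x / 2) : MvPolynomial (Fin n) K) := by
    intro x
    rw [show (2 : MvPolynomial (Fin n) K) = C 2 from (map_ofNat C 2).symm, ← C_mul]
    congr 1; field_simp
  have e1 : ∀ x : K, ∑ j : Fin n, ∑ k : Fin n, (X j * X k * C x : MvPolynomial (Fin n) K)
      = C x * (∑ j, X j) ^ 2 := by
    intro x
    rw [sq, Finset.sum_mul_sum, Finset.mul_sum]
    refine Finset.sum_congr rfl fun j _ => ?_
    rw [Finset.mul_sum]
    refine Finset.sum_congr rfl fun k _ => ?_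
    ring
  rw [aux_expand _ (hquad i)]
  simp only [h, C_add, mul_add, Finset.sum_add_distrib, e1, apply_ite (C (σ := Fin n)), C_0, mul_ite, mul_zero,
    Finset.sum_ite_eq, Finset.sum_ite_eq', Finset.mem_univ, if_true, Finset.sum_ite_irrel, Finset.sum_const_zero]
  have e2 : ∑ k : Fin n, (X i * X k * C B : MvPolynomial (Fin n) K)
      = C B * X i * (∑ j, X j) := by
    rw [Finset.mul_sum]; exact Finset.sum_congr rfl fun k _ => by ring
  have e3 : ∑ k : Fin n, (X k * X i * C B' : MvPolynomial (Fin n) K)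
      = C B' * X i * (∑ j, X j) := by
    rw [Finset.mul_sum]; exact Finset.sum_congr rfl fun k _ => by ring
  have e4 : ∑ k : Fin n, (X k * X k * C E : MvPolynomial (Fin n) K)
      = C E * (∑ j, X j ^ 2) := by
    rw [Finset.mul_sum]; exact Finset.sum_congr rfl fun k _ => by ring
  rw [e2, e3, e4, add_div, C_add, hc A, hc B, hc B', hc E, hc D]
  ring

theorem aux_reg {n : ℕ} {K : Type*} [Field K] (f : Fin n → MvPolynomial (Fin n) K)
    (hreg : RingTheory.Sequence.IsRegular (MvPolynomial (Fin n) K) (List.ofFn f))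
    (i : Fin n) (r : MvPolynomial (Fin n) K)
    (hr : r * f i ∈ Ideal.span (f '' {j | j < i})) : r ∈ Ideal.span (f '' {j | j < i}) := by
  have h := hreg.regular_mod_prev i (by simp)
  have hset : Ideal.ofList ((List.ofFn f).take i) = Ideal.span (f '' {j | j < i}) := by
    unfold Ideal.ofList
    congr 1
    ext x
    simp only [Set.mem_setOf_eq, List.mem_take_iff_getElem, Set.mem_image, List.length_ofFn,
      List.getElem_ofFn]
    constructor
    · rintro ⟨j, hj, rfl⟩
      exact ⟨⟨j, by omega⟩, by rw [Fin.lt_def]; simp; omega, rfl⟩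
    · rintro ⟨j, hj, rfl⟩
      exact ⟨j, by rw [Fin.lt_def] at hj; omega, rfl⟩
  rw [hset] at h
  have hm : (Ideal.span (f '' {j | j < i}) • ⊤ : Submodule (MvPolynomial (Fin n) K)
      (MvPolynomial (Fin n) K)) = Ideal.span (f '' {j | j < i}) := by
    rw [smul_eq_mul, Ideal.mul_top]
  rw [List.getElem_ofFn] at h
  have h0 := @h (Submodule.Quotient.mk r) 0 (by
    simp only [smul_zero]
    rw [← Submodule.Quotient.mk_smul, Submodule.Quotient.mk_eq_zero, hm, smul_eq_mul, mul_comm]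
    exact hr)
  rwa [Submodule.Quotient.mk_eq_zero, hm] at h0

theorem aux_deg {n : ℕ} {K : Type*} [Field K] (S : Set (MvPolynomial (Fin n) K))
    (hS : ∀ p ∈ S, p.IsHomogeneous 2) (g : MvPolynomial (Fin n) K) (hg : g ∈ Ideal.span S) :
    constantCoeff g = 0 ∧ ∀ k, constantCoeff (pderiv k g) = 0 := by
  have key : ∀ (p : MvPolynomial (Fin n) K) (m : ℕ), m ≠ 0 → p.IsHomogeneous m →
      constantCoeff p = 0 := by
    intro p m hm hp
    rw [constantCoeff_eq]
    exact hp.coeff_eq_zero (by simpa using hm.symm)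
  induction hg using Submodule.span_induction with
  | mem x hx => exact ⟨key x 2 two_ne_zero (hS x hx), fun k => key _ 1 one_ne_zero (hS x hx).pderiv⟩
  | zero => simp
  | add x y _ _ hx hy => simp [hx.1, hx.2, hy.1, hy.2]
  | smul a x _ hx => simp [hx.1, hx.2, pderiv_mul]

/-- If `I = (f₁,…,fₙ)` is a complete intersection of quadrics permuted by the
`Sₙ`-action and `e₁² ∉ I`, then `I + e₁R = (x₁², …, xₙ², e₁)`. -/
theorem ideal_plus_e1R
    (K : Type*) [Field K] [CharZero K] (n : ℕ)
    (f : Fin n → MvPolynomial (Fin n) K)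
    (hquad : ∀ i, (f i).IsHomogeneous 2)
    (hreg : RingTheory.Sequence.IsRegular (MvPolynomial (Fin n) K) (List.ofFn f))
    (hequiv : ∀ (σ : Equiv.Perm (Fin n)) (i : Fin n), rename σ (f i) = f (σ i))
    (e1 : MvPolynomial (Fin n) K) (he1 : e1 = ∑ i, X i)
    (he12 : e1 ^ 2 ∉ Ideal.span (Set.range f)) :
    Ideal.span (Set.range f) ⊔ Ideal.span {e1}
      = Ideal.span (insert e1 (Set.range fun i : Fin n => (X i : MvPolynomial (Fin n) K) ^ 2)) := by
  obtain ⟨a, b, c, d, hf⟩ := aux_form f hquad hequiv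
  rw [← he1] at hf
  set p : MvPolynomial (Fin n) K := ∑ j, X j ^ 2 with hp
  have hfI : ∀ i, f i ∈ Ideal.span (Set.range f) := fun i => Ideal.subset_span ⟨i, rfl⟩
  have hsum : ∑ i, f i = C (a + n * c) * p + C (b + n * d) * e1 ^ 2 := by
    simp only [hf, Finset.sum_add_distrib, ← Finset.mul_sum, ← Finset.sum_mul, ← hp, ← he1,
      Finset.sum_const, Finset.card_univ, Fintype.card_fin, nsmul_eq_mul, C_add, C_mul]
    simp only [mul_assoc, ← Finset.mul_sum, ← Finset.sum_mul, ← he1, map_natCast]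
    ring
  have hunit : ∀ (J : Ideal (MvPolynomial (Fin n) K)) (x : K) (g : MvPolynomial (Fin n) K),
      x ≠ 0 → C x * g ∈ J → g ∈ J := by
    intro J x g hx hg
    have := J.mul_mem_left (C x⁻¹) hg
    rwa [← mul_assoc, ← C_mul, inv_mul_cancel₀ hx, C_1, one_mul] at this
  have hn : 0 < n := by
    rcases Nat.eq_zero_or_pos n with h | h
    · subst h
      exact (he12 (by simp [he1])).elim
    · exact h
  have hanc : a + n * c ≠ 0 := by
    intro h0
    rw [h0, C_0, zero_mul, zero_add] at hsum
    by_cases hb : b + n * d = 0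
    · rw [hb, C_0, zero_mul] at hsum
      obtain ⟨m, rfl⟩ : ∃ m, n = m + 1 := ⟨n - 1, by omega⟩
      have hone := aux_reg f hreg (Fin.last m) 1 (by
        rw [Fin.sum_univ_castSucc] at hsum
        rw [one_mul, eq_neg_of_add_eq_zero_right hsum]
        refine neg_mem (sum_mem fun j _ => Ideal.subset_span ⟨j.castSucc, ?_, rfl⟩)
        exact Fin.castSucc_lt_last j)
      have := (aux_deg _ (by rintro _ ⟨j, _, rfl⟩; exact hquad j) _ hone).1
      simp at this
    · refine he12 (hunit _ _ _ hb ?_)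
      rw [← hsum]
      exact sum_mem fun i _ => hfI i
  -- the forward inclusion and the two memberships
  have he1L : e1 ∈ Ideal.span (Set.range f) ⊔ Ideal.span {e1} :=
    Ideal.mem_sup_right (Ideal.subset_span rfl)
  have hfL : ∀ i, f i ∈ Ideal.span (Set.range f) ⊔ Ideal.span {e1} :=
    fun i => Ideal.mem_sup_left (hfI i)
  have hpL : p ∈ Ideal.span (Set.range f) ⊔ Ideal.span {e1} := by
    refine hunit _ _ _ hanc ?_
    rw [show C (a + n * c) * p = ∑ i, f i - (C (b + n * d) * e1) * e1 by rw [hsum]; ring]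
    exact sub_mem (sum_mem fun i _ => hfL i) (Ideal.mul_mem_left _ _ he1L)
  apply le_antisymm
  · refine sup_le (Ideal.span_le.2 ?_) (Ideal.span_mono (by simp))
    rintro _ ⟨i, rfl⟩
    have h1 : e1 ∈ Ideal.span (insert e1 (Set.range fun i : Fin n =>
      (X i : MvPolynomial (Fin n) K) ^ 2)) := Ideal.subset_span (by simp)
    have h2 : ∀ j, (X j : MvPolynomial (Fin n) K) ^ 2 ∈ Ideal.span (insert e1
      (Set.range fun i : Fin n => (X i : MvPolynomial (Fin n) K) ^ 2)) :=
      fun j => Ideal.subset_span (Set.mem_insert_of_mem _ ⟨j, rfl⟩)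
    rw [SetLike.mem_coe, hf i, sq e1, ← mul_assoc]
    exact add_mem (add_mem (add_mem (Ideal.mul_mem_left _ _ (h2 i)) (Ideal.mul_mem_left _ _ h1))
      (Ideal.mul_mem_left _ _ (sum_mem fun j _ => h2 j))) (Ideal.mul_mem_left _ _ h1)
  · refine Ideal.span_le.2 (Set.insert_subset he1L ?_)
    rintro _ ⟨i, rfl⟩
    simp only [SetLike.mem_coe]
    rcases (by omega : n = 1 ∨ n = 2 ∨ 3 ≤ n) with h | h | h
    · subst h
      have : (X i : MvPolynomial (Fin 1) K) ^ 2 = p := by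
        rw [hp, Fin.sum_univ_one, Subsingleton.elim i 0]
      rw [this]; exact hpL
    · subst h
      refine hunit _ 2 _ two_ne_zero ?_
      rw [Fin.sum_univ_two] at hp he1
      have h2 : (C 2 : MvPolynomial (Fin 2) K) = 2 := map_ofNat C 2
      fin_cases i
      · change C 2 * X 0 ^ 2 ∈ _
        rw [show (C 2 : MvPolynomial (Fin 2) K) * X 0 ^ 2 = p + (X 0 - X 1) * e1 by
          rw [hp, he1, h2]; ring]
        exact add_mem hpL (Ideal.mul_mem_left _ _ he1L)
      · change C 2 * X 1 ^ 2 ∈ _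
        rw [show (C 2 : MvPolynomial (Fin 2) K) * X 1 ^ 2 = p + (X 1 - X 0) * e1 by
          rw [hp, he1, h2]; ring]
        exact add_mem hpL (Ideal.mul_mem_left _ _ he1L)
    · have ha : a ≠ 0 := by
        intro ha
        subst ha
        let i0 : Fin n := ⟨0, by omega⟩
        let i1 : Fin n := ⟨1, by omega⟩
        let i2 : Fin n := ⟨2, by omega⟩
        have h01 : i0 ≠ i1 := by simp [i0, i1]
        have m0 : f i0 ∈ Ideal.span (f '' {j | j < i2}) :=
          Ideal.subset_span ⟨i0, by simp [i0, i2], rfl⟩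
        have m1 : f i1 ∈ Ideal.span (f '' {j | j < i2}) :=
          Ideal.subset_span ⟨i1, by simp [i1, i2], rfl⟩
        have hx := aux_reg f hreg i2 (X i0 - X i1) (by
          rw [show (X i0 - X i1) * f i2 = (X i0 - X i1) * f i0 - (X i0 - X i2) * (f i0 - f i1) by
            rw [hf i0, hf i1, hf i2, C_0]; ring]
          exact sub_mem (Ideal.mul_mem_left _ _ m0) (Ideal.mul_mem_left _ _ (sub_mem m0 m1)))
        have := (aux_deg _ (by rintro _ ⟨j, _, rfl⟩; exact hquad j) _ hx).2 i0
        simp [pderiv_X, h01, h01.symm] at this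
      refine hunit _ a _ ha ?_
      rw [show C a * X i ^ 2 = f i - (C b * X i + C d * e1) * e1 - C c * p by rw [hf i]; ring]
      exact sub_mem (sub_mem (hfL i) (Ideal.mul_mem_left _ _ he1L)) (Ideal.mul_mem_left _ _ hpL)
end
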